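/- Let (M,Q) be a nondegenerate finite quadratic module. Then dim_ℂ Inv(M) = Π_p dim_ℂ Inv(M(p)), the product taken over all primes p dividing |M| (each p-primary component M(p) being itself a nondegenerate finite quadratic module). -/

import Mathlib

noncomputable section

/-- `ℚ/ℤ` as the additive circle of circumference 1. -/
abbrev QZ : Type := AddCircle (1 : ℚ)

lemma expPeriodic : Function.Periodic
    (fun q : ℚ => Complex.exp (2 * Real.pi * Complex.I * (q : ℂ))) 1 := by
  intro x
  push_cast
  rw [mul_add, Complex.exp_add, mul_one, Complex.exp_two_pi_mul_I, mul_one]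

/-- The standard character `e : ℚ/ℤ → ℂ`, `e(t) = exp(2πi t)`. -/
def ee : QZ → ℂ := expPeriodic.lift

variable {M : Type} [AddCommGroup M]

/-- The bilinear form associated to a quadratic form `Q : M → ℚ/ℤ`. -/
def Bf (Q : M → QZ) (x y : M) : QZ := Q (x + y) - Q x - Q y

/-- The Gauss sum `σ(M) = |M|^{-1/2} ∑_{x ∈ M} e(-Q(x))`. -/
def gaussSigma (Q : M → QZ) : ℂ :=
  ((Real.sqrt (Nat.card M) : ℂ))⁻¹ * ∑ᶠ x : M, ee (-(Q x))

/-- The operator `T_M` of the Weil representation: `(T_M λ)(x) = e(Q(x))·λ(x)`. -/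
def Tweil (Q : M → QZ) (lam : M → ℂ) : M → ℂ := fun x => ee (Q x) * lam x

/-- The operator `S_M` of the Weil representation:
`(S_M λ)(y) = σ(M)·|M|^{-1/2}·∑_{x∈M} e(-B(y,x))·λ(x)`. -/
def Sweil (Q : M → QZ) (lam : M → ℂ) : M → ℂ := fun y =>
  gaussSigma Q * ((Real.sqrt (Nat.card M) : ℂ))⁻¹ *
    ∑ᶠ x : M, ee (-(Bf Q y x)) * lam x

/-- The `p`-primary component of an abelian group, as a subgroup. -/
def primaryComp (M : Type) [AddCommGroup M] (p : ℕ) : AddSubgroup M where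
  carrier := {x | ∃ k : ℕ, (p ^ k : ℕ) • x = 0}
  zero_mem' := ⟨0, smul_zero _⟩
  add_mem' := by
    rintro a b ⟨k, hk⟩ ⟨l, hl⟩
    refine ⟨k + l, ?_⟩
    have ha : (p ^ (k + l) : ℕ) • a = 0 := by
      rw [pow_add, mul_comm, mul_smul, hk, smul_zero]
    have hb : (p ^ (k + l) : ℕ) • b = 0 := by
      rw [pow_add, mul_smul, hl, smul_zero]
    rw [smul_add, ha, hb, add_zero]
  neg_mem' := by
    rintro a ⟨k, hk⟩
    exact ⟨k, by rw [smul_neg, hk, neg_zero]⟩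

end

/-- The space of invariants `Inv(M)` of the Weil representation, as a subspace
of `ℂ[M]`. -/
noncomputable def InvSub {M : Type} [AddCommGroup M] [Finite M] (Q : M → QZ) :
    Submodule ℂ (M → ℂ) where
  carrier := {lam | Tweil Q lam = lam ∧ Sweil Q lam = lam}
  zero_mem' := by
    constructor
    · funext x; simp [Tweil]
    · funext y; simp [Sweil]
  add_mem' := by
    letI := Fintype.ofFinite M
    rintro a b ⟨haT, haS⟩ ⟨hbT, hbS⟩
    constructor
    · funext x
      have ha := congrFun haT x
      have hb := congrFun hbT x
      simp only [Tweil, Pi.add_apply] at ha hb ⊢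
      rw [mul_add, ha, hb]
    · funext y
      have ha := congrFun haS y
      have hb := congrFun hbS y
      simp only [Sweil, Pi.add_apply] at ha hb ⊢
      rw [← ha, ← hb]
      simp only [finsum_eq_sum_of_fintype, Pi.add_apply]
      rw [← mul_add, ← Finset.sum_add_distrib]
      congr 1
      exact Finset.sum_congr rfl fun x _ => by ring
  smul_mem' := by
    letI := Fintype.ofFinite M
    rintro c a ⟨haT, haS⟩
    constructor
    · funext x
      have ha := congrFun haT x
      simp only [Tweil, Pi.smul_apply, smul_eq_mul] at ha ⊢
      rw [mul_left_comm, ha]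
    · funext y
      have ha := congrFun haS y
      simp only [Sweil, Pi.smul_apply, smul_eq_mul] at ha ⊢
      have hsum : ∑ᶠ x : M, ee (-(Bf Q y x)) * (c * a x)
          = c * ∑ᶠ x : M, ee (-(Bf Q y x)) * a x := by
        simp only [finsum_eq_sum_of_fintype]
        rw [Finset.mul_sum]
        exact Finset.sum_congr rfl fun x _ => by ring
      rw [hsum, ← ha]; ring

lemma ee_coe (q : ℚ) : ee (q : QZ) = Complex.exp (2 * Real.pi * Complex.I * (q : ℂ)) := rfl

lemma ee_add (s t : QZ) : ee (s + t) = ee s * ee t := by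
  induction s using QuotientAddGroup.induction_on with | H a => ?_
  induction t using QuotientAddGroup.induction_on with | H b => ?_
  have h : ((a : QZ) + (b : QZ)) = ((a + b : ℚ) : QZ) := rfl
  change ee ((a : QZ) + (b : QZ)) = ee (a : QZ) * ee (b : QZ)
  rw [h, ee_coe, ee_coe, ee_coe, ← Complex.exp_add]
  push_cast
  ring_nf

lemma ee_zero : ee 0 = 1 := by
  have : (0 : QZ) = ((0 : ℚ) : QZ) := rfl
  rw [this, ee_coe]; simp

lemma ee_neg_mul (t : QZ) : ee (-t) * ee t = 1 := by
  rw [← ee_add, neg_add_cancel, ee_zero]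

lemma ee_mul_neg (t : QZ) : ee t * ee (-t) = 1 := by
  rw [← ee_add, add_neg_cancel, ee_zero]

lemma ee_nsmul (n : ℕ) (t : QZ) : ee (n • t) = ee t ^ n := by
  induction n with
  | zero => simp [ee_zero]
  | succ k ih => rw [succ_nsmul, ee_add, ih, pow_succ]

lemma ee_eq_one {t : QZ} (h : ee t = 1) : t = 0 := by
  induction t using QuotientAddGroup.induction_on with | H a => ?_
  change ee (a : QZ) = 1 at h
  change (a : QZ) = 0
  rw [ee_coe, Complex.exp_eq_one_iff] at h
  obtain ⟨n, hn⟩ := h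
  have h2 : (2 * Real.pi * Complex.I : ℂ) ≠ 0 := Complex.two_pi_I_ne_zero
  have h3 : (a : ℂ) = n := by
    apply mul_left_cancel₀ h2
    rw [hn]; ring
  have h4 : a = n := by exact_mod_cast h3
  rw [AddCircle.coe_eq_zero_iff]
  exact ⟨n, by simp [h4]⟩

/-- nondegenerate finite quadratic module -/
structure FQM {A : Type} [AddCommGroup A] (Q : A → QZ) : Prop where
  quad : ∀ (n : ℤ) (x : A), Q (n • x) = (n ^ 2 : ℤ) • Q x
  bil : ∀ x x' y : A, Bf Q (x + x') y = Bf Q x y + Bf Q x' y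
  nd : ∀ x : A, (∀ y : A, Bf Q x y = 0) → x = 0

section one
variable {A : Type} [AddCommGroup A] {Q : A → QZ}

lemma Bf_comm (Q : A → QZ) (x y : A) : Bf Q x y = Bf Q y x := by
  unfold Bf; rw [add_comm x y]; abel

lemma FQM.zero (h : FQM Q) : Q 0 = 0 := by
  have := h.quad 0 0
  simpa using this

lemma FQM.neg (h : FQM Q) (x : A) : Q (-x) = Q x := by
  have := h.quad (-1) x
  simpa using this

lemma FQM.bil' (h : FQM Q) (x y y' : A) : Bf Q x (y + y') = Bf Q x y + Bf Q x y' := by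
  rw [Bf_comm, h.bil, Bf_comm Q y, Bf_comm Q y']

lemma Bf_zero_right (h : FQM Q) (x : A) : Bf Q x 0 = 0 := by
  unfold Bf; simp [h.zero]

lemma Bf_neg_right (h : FQM Q) (x y : A) : Bf Q x (-y) = - Bf Q x y := by
  have := h.bil' x y (-y)
  rw [add_neg_cancel, Bf_zero_right h] at this
  exact (neg_eq_of_add_eq_zero_right this.symm).symm

lemma sum_char [Fintype A] (h : FQM Q) {t : A} (ht : t ≠ 0) :
    ∑ x : A, ee (Bf Q x t) = 0 := by
  have : ∃ x0, Bf Q x0 t ≠ 0 := by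
    by_contra! hc
    exact ht (h.nd t fun y => by rw [Bf_comm]; exact hc y)
  obtain ⟨x0, hx0⟩ := this
  have h1 : ee (Bf Q x0 t) ≠ 1 := fun h => hx0 (ee_eq_one h)
  have h2 : ee (Bf Q x0 t) * ∑ x : A, ee (Bf Q x t) = ∑ x : A, ee (Bf Q x t) := by
    rw [Finset.mul_sum, ← Equiv.sum_comp (Equiv.addLeft x0) (fun x => ee (Bf Q x t))]
    refine Finset.sum_congr rfl fun x _ => ?_
    simp only [Equiv.coe_addLeft]
    rw [h.bil, ee_add]
  have h3 : (ee (Bf Q x0 t) - 1) * ∑ x : A, ee (Bf Q x t) = 0 := by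
    rw [sub_mul, h2]; ring
  exact (mul_eq_zero.mp h3).resolve_left (sub_ne_zero.mpr h1)

lemma gauss_norm [Fintype A] (h : FQM Q) :
    (∑ x : A, ee (-(Q x))) * ∑ z : A, ee (Q z) = Fintype.card A := by
  classical
  rw [Finset.sum_mul]
  have h1 : ∀ x : A, ee (-(Q x)) * ∑ z : A, ee (Q z) = ∑ t : A, ee (Q t) * ee (Bf Q x t) := by
    intro x
    rw [← Equiv.sum_comp (Equiv.addLeft x) (fun z => ee (Q z)), Finset.mul_sum]
    refine Finset.sum_congr rfl fun t _ => ?_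
    simp only [Equiv.coe_addLeft]
    rw [← ee_add, ← ee_add]
    unfold Bf
    congr 1
    abel
  simp_rw [h1]
  rw [Finset.sum_comm]
  simp_rw [← Finset.mul_sum]
  rw [Finset.sum_eq_single 0]
  · simp [Bf_zero_right h, h.zero, ee_zero]
  · intro t _ ht
    rw [sum_char h ht, mul_zero]
  · simp

lemma sqrt_card_ne [Finite A] : ((Real.sqrt (Nat.card A) : ℝ) : ℂ) ≠ 0 := by
  have : (0:ℝ) < Nat.card A := by exact_mod_cast Nat.card_pos
  exact_mod_cast (Real.sqrt_pos.mpr this).ne'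

lemma sqrt_card_sq : ((Real.sqrt (Nat.card A) : ℝ) : ℂ) * ((Real.sqrt (Nat.card A) : ℝ) : ℂ)
    = Nat.card A := by
  rw [← Complex.ofReal_mul, Real.mul_self_sqrt (by positivity)]; simp

lemma weil_rel [Finite A] (h : FQM Q) (f : A → ℂ) (y : A) :
    Sweil Q (Tweil Q (Sweil Q f)) y = ee (-(Q y)) * Sweil Q (fun x => ee (-(Q x)) * f x) y := by
  letI := Fintype.ofFinite A
  simp only [Sweil, Tweil, finsum_eq_sum_of_fintype]
  set r := ((Real.sqrt (Nat.card A) : ℝ) : ℂ) with hr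
  have hr0 : r ≠ 0 := sqrt_card_ne
  set g := gaussSigma Q with hg
  have hgs : g * r⁻¹ * ∑ z : A, ee (Q z) = 1 := by
    have h1 := gauss_norm h
    have h2 : r * r = Nat.card A := sqrt_card_sq
    rw [hg, gaussSigma, finsum_eq_sum_of_fintype, ← hr]
    rw [← Nat.card_eq_fintype_card, ← h2] at h1
    calc _ = r⁻¹ * r⁻¹ * ((∑ x : A, ee (-(Q x))) * ∑ z : A, ee (Q z)) := by ring
      _ = 1 := by rw [h1]; field_simp
  have key : ∀ x : A, ∑ z : A, ee (-(Bf Q y z)) * ee (Q z) * ee (-(Bf Q z x))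
      = (∑ z : A, ee (Q z)) * (ee (-(Q y)) * ee (-(Bf Q y x)) * ee (-(Q x))) := by
    intro x
    rw [← Equiv.sum_comp (Equiv.addRight (-(y + x))) (fun z => ee (Q z)), Finset.sum_mul]
    refine Finset.sum_congr rfl fun z _ => ?_
    simp only [Equiv.coe_addRight]
    simp only [← ee_add]
    congr 1
    have e1 : Q (z + -(y + x)) = Q z + Q (y + x) - Bf Q z (y + x) := by
      have : Bf Q z (-(y + x)) = - Bf Q z (y + x) := Bf_neg_right h _ _
      rw [← h.neg (y + x), sub_eq_add_neg, ← this]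
      unfold Bf; abel
    rw [e1, h.bil', Bf_comm Q y z]
    have e2 : Q (y + x) = Q y + Q x + Bf Q y x := by unfold Bf; abel
    rw [e2]; abel
  calc _ = g * r⁻¹ * (g * r⁻¹) * ∑ x : A, (∑ z : A, ee (-(Bf Q y z)) * ee (Q z) * ee (-(Bf Q z x))) * f x := by
        rw [mul_assoc (g * r⁻¹)]
        congr 1
        simp_rw [Finset.sum_mul, Finset.mul_sum]
        rw [Finset.sum_comm]
        refine Finset.sum_congr rfl fun z _ => ?_
        refine Finset.sum_congr rfl fun x _ => ?_
        ring
    _ = (g * r⁻¹ * ∑ z : A, ee (Q z)) * ((g * r⁻¹) * ∑ x : A, (ee (-(Q y)) * ee (-(Bf Q y x)) * ee (-(Q x))) * f x) := by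
        simp_rw [key, mul_assoc, Finset.mul_sum]
        exact Finset.sum_congr rfl fun x _ => by ring
    _ = _ := by
        rw [hgs, one_mul, Finset.mul_sum, Finset.mul_sum, Finset.mul_sum]
        refine Finset.sum_congr rfl fun x _ => ?_
        ring

/-- the key step -/
lemma S_fix [Finite A] (h : FQM Q) (f g : A → ℂ) (hf : Tweil Q f = f) (hg : Tweil Q g = g)
    (hS : Sweil Q g = f) : Sweil Q f = f := by
  have inv : ∀ {k : A → ℂ}, Tweil Q k = k → ∀ x, ee (-(Q x)) * k x = k x := by
    intro k hk x
    have := congrFun hk x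
    simp only [Tweil] at this
    nth_rw 1 [← this]
    rw [← mul_assoc, ee_neg_mul, one_mul]
  funext y
  have := weil_rel h g y
  rw [hS, hf] at this
  rw [this, show (fun x => ee (-(Q x)) * g x) = g from funext (inv hg), hS, inv hf]

end one

lemma FQM.ee_pow {A : Type} [AddCommGroup A] [Finite A] {Q : A → QZ} (h : FQM Q) (x : A) :
    ee (Q x) ^ (Nat.card A ^ 2) = 1 := by
  have h1 := h.quad (Nat.card A : ℤ) x
  rw [natCast_zsmul, card_nsmul_eq_zero', h.zero] at h1
  have h2 : (Nat.card A ^ 2 : ℕ) • Q x = 0 := by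
    rw [h1, ← natCast_zsmul]; push_cast; rfl
  rw [← ee_nsmul, h2, ee_zero]

section two
variable {A B : Type} [AddCommGroup A] [AddCommGroup B]

/-- orthogonal sum -/
def Qprod (QA : A → QZ) (QB : B → QZ) : A × B → QZ := fun x => QA x.1 + QB x.2

lemma Bf_prod (QA : A → QZ) (QB : B → QZ) (x y : A × B) :
    Bf (Qprod QA QB) x y = Bf QA x.1 y.1 + Bf QB x.2 y.2 := by
  simp only [Bf, Qprod, Prod.fst_add, Prod.snd_add]; abel

lemma gauss_prod [Finite A] [Finite B] (QA : A → QZ) (QB : B → QZ) :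
    gaussSigma (Qprod QA QB) = gaussSigma QA * gaussSigma QB := by
  have := Fintype.ofFinite A
  have := Fintype.ofFinite B
  simp only [gaussSigma, finsum_eq_sum_of_fintype, Nat.card_prod, Nat.cast_mul]
  rw [Real.sqrt_mul (by positivity), Complex.ofReal_mul, mul_inv, Fintype.sum_prod_type]
  have : ∑ x : A, ∑ y : B, ee (-(Qprod QA QB (x, y)))
      = (∑ x : A, ee (-(QA x))) * ∑ y : B, ee (-(QB y)) := by
    rw [Finset.sum_mul_sum]
    refine Finset.sum_congr rfl fun x _ => Finset.sum_congr rfl fun y _ => ?_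
    rw [← ee_add]; simp only [Qprod]; congr 1; abel
  rw [this]; ring

lemma Sweil_prod [Finite A] [Finite B] (QA : A → QZ) (QB : B → QZ) (f : A × B → ℂ) (a : A) (b : B) :
    Sweil (Qprod QA QB) f (a, b)
      = Sweil QA (fun a' => Sweil QB (fun b' => f (a', b')) b) a := by
  have := Fintype.ofFinite A
  have := Fintype.ofFinite B
  simp only [Sweil, gauss_prod, finsum_eq_sum_of_fintype, Nat.card_prod, Nat.cast_mul]
  rw [Real.sqrt_mul (by positivity), Complex.ofReal_mul, mul_inv, Fintype.sum_prod_type]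
  simp_rw [Finset.mul_sum]
  refine Finset.sum_congr rfl fun x _ => Finset.sum_congr rfl fun y _ => ?_
  rw [Bf_prod, neg_add, ee_add]; ring

lemma Sweil_prod' [Finite A] [Finite B] (QA : A → QZ) (QB : B → QZ) (f : A × B → ℂ) (a : A) (b : B) :
    Sweil (Qprod QA QB) f (a, b)
      = Sweil QB (fun b' => Sweil QA (fun a' => f (a', b')) a) b := by
  have := Fintype.ofFinite A
  have := Fintype.ofFinite B
  rw [Sweil_prod]
  simp only [Sweil, finsum_eq_sum_of_fintype]
  simp_rw [Finset.mul_sum]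
  rw [Finset.sum_comm]
  refine Finset.sum_congr rfl fun x _ => Finset.sum_congr rfl fun y _ => ?_
  ring

lemma mem_InvSub [Finite A] (Q : A → QZ) (f : A → ℂ) :
    f ∈ InvSub Q ↔ Tweil Q f = f ∧ Sweil Q f = f := Iff.rfl

lemma Tweil_Sweil [Finite A] [Finite B] (QA : A → QZ) (QB : B → QZ) (f : A × B → ℂ)
    (h : ∀ b, Tweil QA (fun a => f (a, b)) = fun a => f (a, b)) (b : B) :
    Tweil QA (fun a => Sweil QB (fun b' => f (a, b')) b) = fun a => Sweil QB (fun b' => f (a, b')) b := by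
  have := Fintype.ofFinite B
  funext a
  simp only [Tweil, Sweil, finsum_eq_sum_of_fintype]
  simp_rw [Finset.mul_sum]
  refine Finset.sum_congr rfl fun x _ => ?_
  have := congrFun (h x) a
  simp only [Tweil] at this
  nth_rw 2 [← this]
  ring

lemma mem_prod [Finite A] [Finite B] {QA : A → QZ} {QB : B → QZ} (hA : FQM QA) (hB : FQM QB)
    (hco : (Nat.card A).Coprime (Nat.card B)) (f : A × B → ℂ) :
    f ∈ InvSub (Qprod QA QB) ↔
      (∀ b, (fun a => f (a, b)) ∈ InvSub QA) ∧ ∀ a, (fun b => f (a, b)) ∈ InvSub QB := by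
  constructor
  · rintro ⟨hT, hS⟩
    have key : ∀ a b, f (a, b) ≠ 0 → ee (QA a) = 1 ∧ ee (QB b) = 1 := by
      intro a b hab
      have h1 := congrFun hT (a, b)
      simp only [Tweil, Qprod] at h1
      have h2 : ee (QA a) * ee (QB b) = 1 := by
        rw [← ee_add]
        exact mul_right_cancel₀ hab (by rw [h1, one_mul])
      have h3 := hA.ee_pow a
      have h4 := hB.ee_pow b
      have h5 : ee (QA a) ^ (Nat.card B ^ 2) = 1 := by
        have := congrArg (· ^ (Nat.card B ^ 2)) h2
        simpa [mul_pow, h4] using this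
      have h6 : ee (QA a) = 1 := by
        have := pow_gcd_eq_one.mpr ⟨h3, h5⟩
        rwa [(Nat.Coprime.pow 2 2 hco : Nat.gcd _ _ = 1), pow_one] at this
      exact ⟨h6, by simpa [h6] using h2⟩
    have hTA : ∀ b, Tweil QA (fun a => f (a, b)) = fun a => f (a, b) := by
      intro b; funext a
      simp only [Tweil]
      by_cases h : f (a, b) = 0
      · simp [h]
      · rw [(key a b h).1, one_mul]
    have hTB : ∀ a, Tweil QB (fun b => f (a, b)) = fun b => f (a, b) := by
      intro a; funext b
      simp only [Tweil]
      by_cases h : f (a, b) = 0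
      · simp [h]
      · rw [(key a b h).2, one_mul]
    refine ⟨fun b => ⟨hTA b, ?_⟩, fun a => ⟨hTB a, ?_⟩⟩
    · refine S_fix hA _ (fun a => Sweil QB (fun b' => f (a, b')) b) (hTA b) (Tweil_Sweil QA QB f hTA b) ?_
      funext a
      rw [← Sweil_prod, hS]
    · refine S_fix hB _ (fun b => Sweil QA (fun a' => f (a', b)) a) (hTB a)
        (Tweil_Sweil QB QA (fun x => f (x.2, x.1)) hTB a) ?_
      funext b
      rw [← Sweil_prod', hS]
  · rintro ⟨h1, h2⟩
    constructor
    · funext ⟨a, b⟩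
      have e1 := congrFun (h1 b).1 a
      have e2 := congrFun (h2 a).1 b
      simp only [Tweil, Qprod] at e1 e2 ⊢
      rw [ee_add, mul_assoc, e2, e1]
    · funext ⟨a, b⟩
      rw [Sweil_prod]
      have : (fun a' => Sweil QB (fun b' => f (a', b')) b) = fun a' => f (a', b) := by
        funext a'
        exact congrFun (h2 a').2 b
      rw [this]
      exact congrFun (h1 b).2 a

end two

lemma finrank_tensor {A B : Type} [Finite A] [Finite B] (V : Submodule ℂ (A → ℂ))
    (W : Submodule ℂ (B → ℂ)) (U : Submodule ℂ (A × B → ℂ))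
    (hU : ∀ f, f ∈ U ↔ (∀ b, (fun a => f (a, b)) ∈ V) ∧ ∀ a, (fun b => f (a, b)) ∈ W) :
    Module.finrank ℂ U = Module.finrank ℂ V * Module.finrank ℂ W := by
  classical
  have := Fintype.ofFinite A
  have := Fintype.ofFinite B
  let v := Module.finBasis ℂ V
  let F : (Fin (Module.finrank ℂ V) → W) →ₗ[ℂ] (A × B → ℂ) :=
    { toFun := fun w x => ∑ i, (v i : A → ℂ) x.1 * (w i : B → ℂ) x.2
      map_add' := by
        intro w w'; funext x
        simp [mul_add, Finset.sum_add_distrib]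
      map_smul' := by
        intro c w; funext x
        simp only [Pi.smul_apply, Submodule.coe_smul, smul_eq_mul, RingHom.id_apply, Finset.mul_sum]
        exact Finset.sum_congr rfl fun i _ => by ring }
  have hF : ∀ w x, F w x = ∑ i, (v i : A → ℂ) x.1 * (w i : B → ℂ) x.2 := fun _ _ => rfl
  have hinj : Function.Injective F := by
    rw [← LinearMap.ker_eq_bot, LinearMap.ker_eq_bot']
    intro w hw
    have h0 : ∀ b i, (w i : B → ℂ) b = 0 := by
      intro b
      apply Fintype.linearIndependent_iff.mp v.linearIndependent (fun i => (w i : B → ℂ) b)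
      ext a
      have := congrFun hw (a, b)
      rw [hF] at this
      simp only [Pi.zero_apply] at this
      rw [AddSubmonoidClass.coe_finsetSum, Finset.sum_apply]
      simpa [mul_comm] using this
    funext i
    ext b
    exact h0 b i
  have hrange : LinearMap.range F = U := by
    apply le_antisymm
    · rintro _ ⟨w, rfl⟩
      rw [hU]
      constructor
      · intro b
        have : (fun a => F w (a, b)) = ∑ i, (w i : B → ℂ) b • (v i : A → ℂ) := by
          funext a; simp [hF, mul_comm]
        rw [this]
        exact V.sum_mem fun i _ => V.smul_mem _ (v i).2
      · intro a
        have : (fun b => F w (a, b)) = ∑ i, (v i : A → ℂ) a • (w i : B → ℂ) := by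
          funext b; simp [hF]
        rw [this]
        exact W.sum_mem fun i _ => W.smul_mem _ (w i).2
    · intro f hf
      rw [hU] at hf
      obtain ⟨P, hP⟩ := LinearMap.exists_leftInverse_of_injective V.subtype (by simp)
      have hw : ∀ i, (fun b => v.repr (P (fun a => f (a, b))) i) ∈ W := by
        intro i
        have : (fun b => v.repr (P (fun a => f (a, b))) i)
            = ∑ a, (v.repr (P (Pi.single a 1)) i) • (fun b => f (a, b)) := by
          funext b
          have e : (fun a => f (a, b)) = ∑ a, f (a, b) • (Pi.single a (1 : ℂ) : A → ℂ) := by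
            funext a'
            simp [Finset.sum_apply, Pi.single_apply]
          rw [e]
          simp [mul_comm]
        rw [this]
        exact W.sum_mem fun a _ => W.smul_mem _ (hf.2 a)
      refine ⟨fun i => ⟨_, hw i⟩, ?_⟩
      funext ⟨a, b⟩
      rw [hF]
      have e1 : P (fun a => f (a, b)) = ⟨_, hf.1 b⟩ := LinearMap.congr_fun hP ⟨_, hf.1 b⟩
      have e2 := congrArg (fun z : V => (z : A → ℂ) a) (v.sum_repr (P (fun a => f (a, b))))
      rw [AddSubmonoidClass.coe_finsetSum, Finset.sum_apply] at e2
      nth_rw 2 [e1] at e2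
      refine Eq.trans ?_ e2
      simp [mul_comm]
  rw [← hrange, LinearMap.finrank_range_of_inj hinj, Module.finrank_pi_fintype]
  simp

lemma finrank_InvSub_prod {A B : Type} [AddCommGroup A] [AddCommGroup B] [Finite A] [Finite B]
    {QA : A → QZ} {QB : B → QZ} (hA : FQM QA) (hB : FQM QB)
    (hco : (Nat.card A).Coprime (Nat.card B)) :
    Module.finrank ℂ (InvSub (Qprod QA QB))
      = Module.finrank ℂ (InvSub QA) * Module.finrank ℂ (InvSub QB) :=
  finrank_tensor _ _ _ (mem_prod hA hB hco)

lemma finrank_InvSub_equiv {A B : Type} [AddCommGroup A] [AddCommGroup B] [Finite A] [Finite B]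
    (e : A ≃+ B) (QA : A → QZ) (QB : B → QZ) (h : ∀ a, QB (e a) = QA a) :
    Module.finrank ℂ (InvSub QA) = Module.finrank ℂ (InvSub QB) := by
  have := Fintype.ofFinite A
  have := Fintype.ofFinite B
  let E : (B → ℂ) ≃ₗ[ℂ] (A → ℂ) := LinearEquiv.funCongrLeft ℂ ℂ e.toEquiv
  have hE : ∀ f a, E f a = f (e a) := fun _ _ => rfl
  have hcard : Nat.card A = Nat.card B := Nat.card_congr e.toEquiv
  have hB : ∀ x y, Bf QB (e x) (e y) = Bf QA x y := by
    intro x y; simp only [Bf, ← map_add, h]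
  have hT : ∀ f, Tweil QA (E f) = E (Tweil QB f) := by
    intro f; funext a; simp only [Tweil, hE, h]
  have hg : gaussSigma QA = gaussSigma QB := by
    simp only [gaussSigma, hcard, finsum_eq_sum_of_fintype]
    rw [← Equiv.sum_comp e.toEquiv (fun x => ee (-(QB x)))]
    simp [h]
  have hS : ∀ f, Sweil QA (E f) = E (Sweil QB f) := by
    intro f; funext a
    rw [hE]
    simp only [Sweil, hg, hcard, finsum_eq_sum_of_fintype]
    rw [← Equiv.sum_comp e.toEquiv (fun x => ee (-(Bf QB (e a) x)) * f x)]
    simp [hB, hE]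
  have hmap : (InvSub QB).map E.toLinearMap = InvSub QA := by
    ext f
    constructor
    · rintro ⟨g, ⟨h1, h2⟩, rfl⟩
      exact ⟨(hT g).trans (congrArg E h1), (hS g).trans (congrArg E h2)⟩
    · rintro ⟨h1, h2⟩
      refine ⟨E.symm f, ⟨?_, ?_⟩, E.apply_symm_apply f⟩
      · apply E.injective; rw [← hT]; simpa using h1
      · apply E.injective; rw [← hS]; simpa using h2
  rw [← hmap]
  exact LinearEquiv.finrank_map_eq E (InvSub QB)

section three
variable {M : Type} [AddCommGroup M]

/-- `n`-torsion -/
def torN (M : Type) [AddCommGroup M] (n : ℕ) : AddSubgroup M := (nsmulAddMonoidHom (α := M) n).ker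

lemma mem_torN (n : ℕ) (x : M) : x ∈ torN M n ↔ n • x = 0 := Iff.rfl

lemma eq_zero_of_coprime {G : Type*} [AddCommGroup G] {a b : ℕ} (h : a.Coprime b) {x : G} (ha : a • x = 0)
    (hb : b • x = 0) : x = 0 := by
  rw [← addOrderOf_dvd_iff_nsmul_eq_zero] at ha hb
  have := Nat.dvd_gcd ha hb
  rw [h, Nat.dvd_one, AddMonoid.addOrderOf_eq_one_iff] at this
  exact this

lemma Bf_nsmul_left {Q : M → QZ} (h : FQM Q) (n : ℕ) (x y : M) : Bf Q (n • x) y = n • Bf Q x y := by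
  induction n with
  | zero => rw [zero_nsmul, zero_nsmul, Bf_comm, Bf_zero_right h]
  | succ k ih => rw [succ_nsmul, succ_nsmul, h.bil, ih]

lemma Bf_orth {Q : M → QZ} (h : FQM Q) {a b : ℕ} (hab : a.Coprime b) {x y : M}
    (hx : x ∈ torN M a) (hy : y ∈ torN M b) : Bf Q x y = 0 := by
  rw [mem_torN] at hx hy
  apply eq_zero_of_coprime hab
  · rw [← Bf_nsmul_left h, hx, Bf_comm, Bf_zero_right h]
  · rw [Bf_comm, ← Bf_nsmul_left h, hy, Bf_comm, Bf_zero_right h]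

lemma exists_split [Finite M] {a b : ℕ} (hab : a.Coprime b) (hc : Nat.card M = a * b) (m : M) :
    ∃ x ∈ torN M a, ∃ y ∈ torN M b, x + y = m := by
  have hm : (a * b) • m = 0 := by rw [← hc]; exact card_nsmul_eq_zero'
  have hbez : (a : ℤ) * Nat.gcdA a b + b * Nat.gcdB a b = 1 := by
    rw [← Nat.gcd_eq_gcd_ab, hab.gcd_eq_one]; rfl
  refine ⟨Nat.gcdB a b • b • m, ?_, Nat.gcdA a b • a • m, ?_, ?_⟩
  · rw [mem_torN, smul_comm, smul_smul a b, hm, smul_zero]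
  · rw [mem_torN, smul_comm, smul_smul b a, mul_comm b a, hm, smul_zero]
  · rw [← natCast_zsmul, ← natCast_zsmul, smul_smul, smul_smul, ← add_smul]
    rw [show Nat.gcdB a b * (b : ℤ) + Nat.gcdA a b * (a : ℤ) = 1 by linarith, one_smul]

/-- the splitting -/
noncomputable def splitEquiv [Finite M] {a b : ℕ} (hab : a.Coprime b) (hc : Nat.card M = a * b) :
    torN M a × torN M b ≃+ M :=
  AddEquiv.ofBijective ((torN M a).subtype.coprod (torN M b).subtype) (by
    constructor
    · rw [injective_iff_map_eq_zero]
      rintro ⟨⟨x, hx⟩, ⟨y, hy⟩⟩ h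
      have h' : x + y = 0 := h
      have hxy : x = -y := eq_neg_of_add_eq_zero_left h'
      have hx0 : x = 0 := by
        apply eq_zero_of_coprime hab hx
        rw [hxy, smul_neg, (mem_torN b y).mp hy, neg_zero]
      have hy0 : y = 0 := by simpa [hx0] using h'
      subst hx0; subst hy0; rfl
    · intro m
      obtain ⟨x, hx, y, hy, rfl⟩ := exists_split hab hc m
      exact ⟨(⟨x, hx⟩, ⟨y, hy⟩), rfl⟩)

lemma splitEquiv_apply [Finite M] {a b : ℕ} (hab : a.Coprime b) (hc : Nat.card M = a * b)
    (z : torN M a × torN M b) : splitEquiv hab hc z = (z.1 : M) + z.2 := rfl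

lemma card_torN_coprime [Finite M] {a b : ℕ} (hab : a.Coprime b) :
    (Nat.card (torN M a)).Coprime b := by
  rw [Nat.coprime_iff_isRelPrime] 
  by_contra hcon
  rw [← Nat.coprime_iff_isRelPrime, Nat.Prime.not_coprime_iff_dvd] at hcon
  obtain ⟨q, hq, h1, h2⟩ := hcon
  have := Fact.mk hq
  obtain ⟨x, hx⟩ := exists_prime_addOrderOf_dvd_card' q h1
  have h3 : a • x = 0 := Subtype.ext x.2
  rw [← addOrderOf_dvd_iff_nsmul_eq_zero, hx] at h3
  exact Nat.Prime.not_coprime_iff_dvd.mpr ⟨q, hq, h3, h2⟩ hab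

lemma card_torN [Finite M] {a b : ℕ} (hab : a.Coprime b) (hc : Nat.card M = a * b) :
    Nat.card (torN M a) = a := by
  have h1 := Nat.card_congr (splitEquiv hab hc).toEquiv
  rw [Nat.card_prod, hc] at h1
  apply Nat.dvd_antisymm
  · exact (card_torN_coprime hab).dvd_of_dvd_mul_right (Dvd.intro _ h1)
  · exact (card_torN_coprime hab.symm).symm.dvd_of_dvd_mul_right (Dvd.intro _ h1.symm)

lemma FQM.torN [Finite M] {Q : M → QZ} (h : FQM Q) {a b : ℕ} (hab : a.Coprime b)
    (hc : Nat.card M = a * b) : FQM (fun x : torN M a => Q (x : M)) where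
  quad n x := h.quad n x
  bil x y z := h.bil x y z
  nd x hx := by
    apply Subtype.ext
    apply h.nd
    intro m
    obtain ⟨y, hy, z, hz, rfl⟩ := exists_split hab hc m
    rw [h.bil', Bf_orth h hab x.2 hz, add_zero]
    exact hx ⟨y, hy⟩

lemma finrank_split [Finite M] {Q : M → QZ} (h : FQM Q) {a b : ℕ} (hab : a.Coprime b)
    (hc : Nat.card M = a * b) :
    Module.finrank ℂ (InvSub Q) = Module.finrank ℂ (InvSub (fun x : torN M a => Q (x : M))) *
      Module.finrank ℂ (InvSub (fun x : torN M b => Q (x : M))) := by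
  have hc' : Nat.card M = b * a := by rw [hc, mul_comm]
  rw [← finrank_InvSub_prod (h.torN hab hc) (h.torN hab.symm hc')
    (by rw [card_torN hab hc, card_torN hab.symm hc']; exact hab)]
  symm
  apply finrank_InvSub_equiv (splitEquiv hab hc)
  rintro ⟨x, y⟩
  rw [splitEquiv_apply]
  have := Bf_orth h hab x.2 y.2
  unfold Bf at this
  simp only [Qprod]
  rw [← sub_eq_zero, ← this]; abel

lemma finrank_primary [Finite M] (Q : M → QZ) {a b : ℕ} (hab : a.Coprime b)
    (hc : Nat.card M = a * b) {p : ℕ} (hp : p.Prime) (hpa : p ∣ a) :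
    Module.finrank ℂ (InvSub (fun x : primaryComp (torN M a) p => Q ((x : torN M a) : M)))
     = Module.finrank ℂ (InvSub (fun x : primaryComp M p => Q (x : M))) := by
  have hin : ∀ x ∈ primaryComp M p, x ∈ torN M a := by
    rintro x ⟨k, hk⟩
    rw [mem_torN, ← addOrderOf_dvd_iff_nsmul_eq_zero]
    rw [← addOrderOf_dvd_iff_nsmul_eq_zero] at hk
    have h1 : addOrderOf x ∣ a * b := hc ▸ addOrderOf_dvd_natCard x
    refine Nat.Coprime.dvd_of_dvd_mul_right ?_ h1
    exact Nat.Coprime.coprime_dvd_left hk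
      (Nat.Coprime.pow_left k (Nat.Coprime.coprime_dvd_left hpa hab))
  let φ : primaryComp (torN M a) p →+ primaryComp M p :=
    { toFun := fun x => ⟨((x : torN M a) : M), by
        obtain ⟨k, hk⟩ := x.2
        exact ⟨k, congrArg Subtype.val hk⟩⟩
      map_zero' := rfl
      map_add' := fun _ _ => rfl }
  have hφ : Function.Bijective φ := by
    constructor
    · intro x y hxy
      have hv : ((φ x : primaryComp M p) : M) = (φ y : primaryComp M p) := by rw [hxy]
      exact Subtype.ext (Subtype.ext hv)
    · rintro ⟨x, hx⟩
      refine ⟨⟨⟨x, hin x hx⟩, ?_⟩, rfl⟩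
      obtain ⟨k, hk⟩ := hx
      exact ⟨k, Subtype.ext hk⟩
  exact finrank_InvSub_equiv (AddEquiv.ofBijective φ hφ) _ _ fun _ => rfl

lemma finrank_trivial [Finite M] {Q : M → QZ} (h : FQM Q) (hc : Nat.card M = 1) :
    Module.finrank ℂ (InvSub Q) = 1 := by
  have := Fintype.ofFinite M
  obtain ⟨hs, _⟩ := Nat.card_eq_one_iff_unique.mp hc
  have hQ : ∀ x, Q x = 0 := fun x => by rw [Subsingleton.elim x 0, h.zero]
  have hB : ∀ x y, Bf Q x y = 0 := fun x y => by simp [Bf, hQ]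
  have hun : ∀ g : M → ℂ, ∑ x, g x = g 0 := fun g => Fintype.sum_subsingleton g 0
  have htop : InvSub Q = ⊤ := by
    rw [eq_top_iff]
    intro f _
    constructor
    · funext x; simp [Tweil, hQ, ee_zero]
    · funext x
      simp only [Sweil, gaussSigma, hB, hQ, hc, finsum_eq_sum_of_fintype, hun]
      simp [ee_zero, Subsingleton.elim x 0]
  rw [htop, finrank_top, Module.finrank_fintype_fun_eq_card, ← Nat.card_eq_fintype_card, hc]

end three

lemma main_aux (m : ℕ) : ∀ {M : Type} [AddCommGroup M] [Finite M] (Q : M → QZ), FQM Q →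
    Nat.card M = m → Module.finrank ℂ (InvSub Q) =
      ∏ p ∈ m.primeFactors,
        Module.finrank ℂ (InvSub (fun x : primaryComp M p => Q (x : M))) := by
  induction m using Nat.recOnPosPrimePosCoprime with
  | zero => intro M _ _ Q _ h; exact absurd h Nat.card_pos.ne'
  | one => intro M _ _ Q h hc; simpa using finrank_trivial h hc
  | prime_pow p n hp hn =>
    intro M _ _ Q h hc
    rw [Nat.primeFactors_prime_pow hn.ne' hp, Finset.prod_singleton]
    symm
    have htop : primaryComp M p = ⊤ := by
      rw [eq_top_iff]
      intro x _
      exact ⟨n, by rw [← hc]; exact card_nsmul_eq_zero'⟩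
    exact finrank_InvSub_equiv ((AddEquiv.addSubgroupCongr htop).trans AddSubgroup.topEquiv) _ _
      fun _ => rfl
  | coprime a b ha hb hab iha ihb =>
    intro M _ _ Q h hc
    have hc' : Nat.card M = b * a := by rw [hc, mul_comm]
    rw [finrank_split h hab hc, iha _ (h.torN hab hc) (card_torN hab hc),
      ihb _ (h.torN hab.symm hc') (card_torN hab.symm hc'), hab.primeFactors_mul,
      Finset.prod_union hab.disjoint_primeFactors]
    congr 1
    · exact Finset.prod_congr rfl fun p hp => finrank_primary Q hab hc
        (Nat.prime_of_mem_primeFactors hp) (Nat.dvd_of_mem_primeFactors hp)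
    · exact Finset.prod_congr rfl fun p hp => finrank_primary Q hab.symm hc'
        (Nat.prime_of_mem_primeFactors hp) (Nat.dvd_of_mem_primeFactors hp)

/-- `dim Inv(M) = ∏_p dim Inv(M(p))`, the product over the primes
dividing `|M|`. -/
theorem dim_invariants_eq_prod {M : Type} [AddCommGroup M] [Finite M] (Q : M → QZ)
    (hquad : ∀ (n : ℤ) (x : M), Q (n • x) = (n ^ 2 : ℤ) • Q x)
    (hbil : ∀ x x' y : M, Bf Q (x + x') y = Bf Q x y + Bf Q x' y)
    (hnd : ∀ x : M, (∀ y : M, Bf Q x y = 0) → x = 0) :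
    Module.finrank ℂ (InvSub Q) =
      ∏ p ∈ (Nat.card M).primeFactors,
        Module.finrank ℂ (InvSub (fun x : primaryComp M p => Q (x : M))) := by
  exact main_aux _ Q ⟨hquad, hbil, hnd⟩ rfl
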